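/- Let (R, m) be a commutative local ring and let r ≥ 2 be a natural number. Then the following are equivalent: (i) every unimodular row of length r+1 over R[t] is completable; (ii) every unimodular row of length r+1 over R[t,t⁻¹] is completable; (iii) every unimodular row of length r+1 over R⟨t⟩ is completable; (iv) every unimodular row of length r+1 over R((t)) is completable. -/

import Mathlib

open Polynomial

/-- The multiplicative submonoid of monic polynomials in `R[t]`. -/
def monicSubmonoid (R : Type) [CommRing R] : Submonoid (Polynomial R) where
  carrier := {p | p.Monic}
  mul_mem' := fun ha hb => ha.mul hb
  one_mem' := monic_one

/-- `R⟨t⟩`: the localization of `R[t]` at the multiplicative set of monic polynomials. -/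
abbrev MonicLoc (R : Type) [CommRing R] :=
  Localization (monicSubmonoid R)

/-- Unimodular row: the entries generate the unit ideal. -/
def IsUnimodular {A : Type} [CommRing A] {n : ℕ} (v : Fin n → A) : Prop :=
  Ideal.span (Set.range v) = ⊤

/-- A row is completable if it occurs as a row of an invertible square matrix. -/
def IsCompletable {A : Type} [CommRing A] {n : ℕ} (v : Fin n → A) : Prop :=
  ∃ M : Matrix (Fin n) (Fin n) A, IsUnit M ∧ ∃ i, M i = v


open IsLocalRing

/-! ### Nakayama -/

theorem nak_aux {R M : Type} [CommRing R] [IsLocalRing R] [AddCommGroup M] [Module R M]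
    (P V : Submodule R M) (hV : V.FG) (h1 : ⊤ ≤ P ⊔ V)
    (h2 : ⊤ ≤ P ⊔ (maximalIdeal R) • (⊤ : Submodule R M)) : P = ⊤ := by
  have h3 : (maximalIdeal R) • (⊤ : Submodule R M) ≤ P ⊔ (maximalIdeal R) • V := by
    calc (maximalIdeal R) • (⊤ : Submodule R M) ≤ (maximalIdeal R) • (P ⊔ V) :=
          Submodule.smul_mono le_rfl h1
      _ = (maximalIdeal R) • P ⊔ (maximalIdeal R) • V := Submodule.smul_sup _ _ _
      _ ≤ P ⊔ (maximalIdeal R) • V := sup_le_sup_right Submodule.smul_le_right _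
  have h4 : V ≤ P := by
    apply Submodule.le_of_le_smul_of_le_jacobson_bot hV (maximalIdeal_le_jacobson ⊥)
    exact le_top.trans (h2.trans (sup_le le_sup_left h3))
  exact top_le_iff.mp (h1.trans (sup_le le_rfl h4))

/-! ### The abstract patching set-up -/

structure Rob (R A A' L : Type) [CommRing R] [IsLocalRing R] [CommRing A] [CommRing A']
    [CommRing L] [Algebra R A] [Algebra R A'] [Algebra R L] where
  φ : A →ₐ[R] L
  ψ : A' →ₐ[R] L
  mL : Ideal L
  mA' : Ideal A'
  unit_add : ∀ z ∈ mA', IsUnit (1 + z)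
  map_le' : (maximalIdeal R).map (algebraMap R A') ≤ mA'
  map_le : (maximalIdeal R).map (algebraMap R L) ≤ mL
  mL_dec : ∀ x ∈ mL, ∃ y ∈ (maximalIdeal R) • (⊤ : Submodule R L), ∃ z ∈ mA', x = y + ψ z
  dec : ∀ x, ∃ a a', x = φ a + ψ a'
  τ : A'
  bdd : ∀ x, ∃ K : ℕ, ∃ a', ψ (τ ^ K) * x = ψ a'
  fin1 : ∀ K : ℕ, ∃ V : Submodule R A', V.FG ∧ ∀ a', ∃ a'', a' - τ ^ K * a'' ∈ V
  fin2 : ∀ K : ℕ, ∃ W : Submodule R A, W.FG ∧ ∀ a a', ψ (τ ^ K) * φ a = ψ a' → a ∈ W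
  const : ∀ a a', φ a = ψ a' → ∃ c : R, a = algebraMap R A c
  ε : A →ₐ[R] R

theorem Rob.bdd_le {R A A' L : Type} [CommRing R] [IsLocalRing R] [CommRing A] [CommRing A']
    [CommRing L] [Algebra R A] [Algebra R A'] [Algebra R L] (D : Rob R A A' L)
    {ι : Type} [Fintype ι] (x : ι → L) :
    ∃ K : ℕ, ∀ i, ∃ a', D.ψ (D.τ ^ K) * x i = D.ψ a' := by
  choose K a ha using fun i => D.bdd (x i)
  refine ⟨∑ i, K i, fun i => ?_⟩
  have hle : K i ≤ ∑ i, K i := Finset.single_le_sum (f := K) (fun _ _ => Nat.zero_le _)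
    (Finset.mem_univ i)
  refine ⟨D.τ ^ (∑ i, K i - K i) * a i, ?_⟩
  rw [map_mul, ← ha, ← mul_assoc, ← map_mul, ← pow_add, Nat.sub_add_cancel hle]

theorem Rob.unit {R A A' L : Type} [CommRing R] [IsLocalRing R] [CommRing A] [CommRing A']
    [CommRing L] [Algebra R A] [Algebra R A'] [Algebra R L] (D : Rob R A A' L)
    (d c : A) (hd : IsUnit (D.φ d)) (hc : d * c - 1 ∈ (maximalIdeal R).map (algebraMap R A)) :
    IsUnit d := by
  obtain ⟨e, he⟩ := hd.exists_right_inv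
  obtain ⟨K, b, hb⟩ := D.bdd (D.φ d)
  obtain ⟨W, hW, hW2⟩ := D.fin2 K
  let P : Submodule R A := LinearMap.range (LinearMap.mulLeft R d)
  have : P = ⊤ := by
    apply nak_aux P W hW
    · intro a _
      obtain ⟨a1, a', ha⟩ := D.dec (e * D.φ a)
      have h1 : a - d * a1 ∈ W := by
        apply hW2 _ (b * a')
        rw [map_mul, ← hb, map_sub, map_mul, mul_assoc]
        congr 1
        have : D.φ a = D.φ d * (e * D.φ a) := by rw [← mul_assoc, he, one_mul]
        rw [this, ha]; ring
      rw [show a = d * a1 + (a - d * a1) by ring]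
      exact Submodule.add_mem_sup ⟨a1, rfl⟩ h1
    · intro a _
      rw [show a = d * (c * a) + (-(d * c - 1)) * a by ring]
      refine Submodule.add_mem_sup ⟨c * a, rfl⟩ ?_
      rw [Ideal.smul_top_eq_map]
      exact Ideal.mul_mem_right _ _ (neg_mem hc)
  have h1 : (1 : A) ∈ P := this ▸ Submodule.mem_top
  obtain ⟨y, hy⟩ := h1
  exact IsUnit.of_mul_eq_one y hy

theorem mat_mem_smul_top {R M : Type} [CommRing R] [AddCommGroup M] [Module R M] (I : Ideal R)
    {n : ℕ} (X : Matrix (Fin n) (Fin n) M) :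
    X ∈ I • (⊤ : Submodule R (Matrix (Fin n) (Fin n) M)) ↔
      ∀ i j, X i j ∈ I • (⊤ : Submodule R M) := by
  constructor
  · intro h i j
    have := Submodule.mem_map_of_mem (f := Matrix.entryLinearMap R M i j) h
    rw [Submodule.map_smul''] at this
    exact Submodule.smul_mono le_rfl le_top this
  · intro h
    rw [Matrix.matrix_eq_sum_single X]
    refine Submodule.sum_mem _ fun i _ => Submodule.sum_mem _ fun j _ => ?_
    have := Submodule.mem_map_of_mem (f := Matrix.singleLinearMap R i j) (h i j)
    rw [Submodule.map_smul''] at this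
    exact Submodule.smul_mono le_rfl le_top this

theorem mat_mul_mem_ideal {L : Type} [CommRing L] (I : Ideal L) {n : ℕ}
    (X Y : Matrix (Fin n) (Fin n) L) (hY : ∀ i j, Y i j ∈ I) : ∀ i j, (X * Y) i j ∈ I := by
  intro i j
  rw [Matrix.mul_apply]
  exact Ideal.sum_mem _ fun k _ => Ideal.mul_mem_left _ _ (hY _ _)

theorem mat_mul_mem_ideal' {L : Type} [CommRing L] (I : Ideal L) {n : ℕ}
    (X Y : Matrix (Fin n) (Fin n) L) (hX : ∀ i j, X i j ∈ I) : ∀ i j, (X * Y) i j ∈ I := by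
  intro i j
  rw [Matrix.mul_apply]
  exact Ideal.sum_mem _ fun k _ => Ideal.mul_mem_right _ _ (hX _ _)

theorem det_sub_one_mem {L : Type} [CommRing L] (I : Ideal L) {n : ℕ}
    (X : Matrix (Fin n) (Fin n) L) (hX : ∀ i j, (X - 1) i j ∈ I) : X.det - 1 ∈ I := by
  have h : (Ideal.Quotient.mk I).mapMatrix X = 1 := by
    rw [← map_one (Ideal.Quotient.mk I).mapMatrix, ← sub_eq_zero, ← map_sub]
    ext i j
    simpa using Ideal.Quotient.eq_zero_iff_mem.mpr (hX i j)
  rw [← Ideal.Quotient.eq_zero_iff_mem, map_sub, RingHom.map_det, h]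
  simp

theorem Rob.birk {R A A' L : Type} [CommRing R] [IsLocalRing R] [CommRing A] [CommRing A']
    [CommRing L] [Algebra R A] [Algebra R A'] [Algebra R L] (D : Rob R A A' L) {n : ℕ}
    (N N' : Matrix (Fin n) (Fin n) L) (hNN : N * N' = 1) (M0 M1 : Matrix (Fin n) (Fin n) A)
    (hM : ∀ i j, (M0 * M1 - 1) i j ∈ (maximalIdeal R).map (algebraMap R A))
    (hN : ∀ i j, (N - D.φ.mapMatrix M0) i j ∈ D.mL) :
    ∃ (B : Matrix (Fin n) (Fin n) A) (C : Matrix (Fin n) (Fin n) A'), IsUnit B ∧ IsUnit C ∧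
      N * D.ψ.mapMatrix C = D.φ.mapMatrix B := by
  classical
  let f1 : Matrix (Fin n) (Fin n) A →ₗ[R] Matrix (Fin n) (Fin n) L :=
    D.φ.mapMatrix.toLinearMap
  let f2 : Matrix (Fin n) (Fin n) A' →ₗ[R] Matrix (Fin n) (Fin n) L :=
    (LinearMap.mulLeft R N) ∘ₗ D.ψ.mapMatrix.toLinearMap
  have f1a : ∀ Y, f1 Y = D.φ.mapMatrix Y := fun _ => rfl
  have f2a : ∀ Y, f2 Y = N * D.ψ.mapMatrix Y := fun _ => rfl
  let P := LinearMap.range f1 ⊔ LinearMap.range f2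
  -- entrywise decomposition
  have hdec : ∀ X : Matrix (Fin n) (Fin n) L, ∃ Y Z,
      X = D.φ.mapMatrix Y + D.ψ.mapMatrix Z := by
    intro X
    choose Y Z h using fun i j => D.dec (X i j)
    exact ⟨Matrix.of Y, Matrix.of Z, by ext i j; simpa using h i j⟩
  have key : ∀ E : Matrix (Fin n) (Fin n) L, (∀ i j, E i j ∈ D.mL) →
      ∃ y ∈ (maximalIdeal R) • (⊤ : Submodule R (Matrix (Fin n) (Fin n) L)),
      ∃ z : Matrix (Fin n) (Fin n) A', (∀ i j, z i j ∈ D.mA') ∧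
        E = y + N * D.ψ.mapMatrix z := by
    intro E hE
    choose y hy z hz h using fun i j => D.mL_dec _ (mat_mul_mem_ideal D.mL N' E hE i j)
    have h' : N' * E = Matrix.of y + D.ψ.mapMatrix (Matrix.of z) := by
      ext i j; simpa using h i j
    refine ⟨N * Matrix.of y, ?_, Matrix.of z, hz, ?_⟩
    · have : Matrix.of y ∈ (maximalIdeal R) • (⊤ : Submodule R (Matrix (Fin n) (Fin n) L)) :=
        (mat_mem_smul_top _ _).mpr hy
      have := Submodule.mem_map_of_mem (f := LinearMap.mulLeft R N) this
      rw [Submodule.map_smul''] at this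
      exact Submodule.smul_mono le_rfl le_top this
    · rw [← mul_add, ← h', ← mul_assoc, hNN, one_mul]
  have hP : P = ⊤ := by
    obtain ⟨K, hK⟩ := D.bdd_le (fun p : Fin n × Fin n => N' p.1 p.2)
    choose Q hQ using hK
    obtain ⟨V0, hV0, hV⟩ := D.fin1 K
    let V1 : Submodule R (Matrix (Fin n) (Fin n) A') :=
      Submodule.pi Set.univ (fun _ : Fin n => Submodule.pi Set.univ (fun _ : Fin n => V0))
    have hV1 : V1.FG := Submodule.fg_pi fun _ => Submodule.fg_pi fun _ => hV0
    apply nak_aux P (V1.map D.ψ.mapMatrix.toLinearMap) (hV1.map _)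
    · intro X _
      obtain ⟨Y, Z, hX⟩ := hdec X
      choose Z2 hZ2 using fun i j => hV (Z i j)
      have hQ' : D.ψ (D.τ ^ K) • (1 : Matrix (Fin n) (Fin n) L)
          = N * D.ψ.mapMatrix (Matrix.of fun i j => Q (i, j)) := by
        have : D.ψ.mapMatrix (Matrix.of fun i j => Q (i, j)) = D.ψ (D.τ ^ K) • N' := by
          ext i j; simpa using (hQ (i, j)).symm
        rw [this, Matrix.mul_smul, hNN]
      have hX2 : X = (D.φ.mapMatrix Y + N * D.ψ.mapMatrix
          ((Matrix.of fun i j => Q (i, j)) * Matrix.of Z2)) +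
          D.ψ.mapMatrix (Z - D.τ ^ K • Matrix.of Z2) := by
        rw [map_mul, ← mul_assoc, ← hQ', hX]
        ext i j
        simp
      rw [hX2]
      refine Submodule.add_mem_sup (Submodule.add_mem_sup ⟨_, rfl⟩ ⟨_, rfl⟩) ⟨_, ?_, rfl⟩
      intro i _ j _
      simpa using hZ2 i j
    · intro X _
      obtain ⟨Y, Z, hX⟩ := hdec (N' * X)
      obtain ⟨y, hy, z, hz, hE⟩ := key ((N - D.φ.mapMatrix M0) * D.φ.mapMatrix Y)
        (mat_mul_mem_ideal' _ _ _ hN)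
      have hX2 : X = (D.φ.mapMatrix (M0 * Y) + N * D.ψ.mapMatrix (z + Z)) + y := by
        have h1 : X = N * (N' * X) := by rw [← mul_assoc, hNN, one_mul]
        rw [h1, hX, map_mul, map_add, mul_add, mul_add]
        rw [sub_mul, sub_eq_iff_eq_add] at hE
        rw [hE]; abel
      rw [hX2]
      exact Submodule.add_mem_sup (Submodule.add_mem_sup ⟨_, rfl⟩ ⟨_, rfl⟩) hy
  obtain ⟨y, hy, z, hz, hE⟩ := key (N - D.φ.mapMatrix M0) hN
  rw [← hP, Submodule.smul_sup, Submodule.mem_sup] at hy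
  obtain ⟨y1, hy1, y2, hy2, rfl⟩ := hy
  rw [LinearMap.range_eq_map, ← Submodule.map_smul''] at hy1 hy2
  obtain ⟨Y, hY, rfl⟩ := hy1
  obtain ⟨Z, hZ, rfl⟩ := hy2
  rw [f1a, f2a] at hE
  have hYm : ∀ i j, Y i j ∈ (maximalIdeal R).map (algebraMap R A) := by
    intro i j
    have := (mat_mem_smul_top _ _).mp hY i j
    rwa [Ideal.smul_top_eq_map] at this
  have hZm : ∀ i j, Z i j ∈ D.mA' := by
    intro i j
    have := (mat_mem_smul_top _ _).mp hZ i j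
    rw [Ideal.smul_top_eq_map] at this
    exact D.map_le' this
  have hfin : N * D.ψ.mapMatrix (1 - (Z + z)) = D.φ.mapMatrix (M0 + Y) := by
    rw [map_sub, map_one, mul_sub, mul_one, map_add, map_add, mul_add]
    rw [sub_eq_iff_eq_add] at hE
    nth_rewrite 1 [hE]
    abel
  have hC : IsUnit (1 - (Z + z)) := by
    rw [Matrix.isUnit_iff_isUnit_det]
    have := D.unit_add ((1 - (Z + z)).det - 1) (det_sub_one_mem _ _ (fun i j => by
      have : (1 - (Z + z) - 1) i j = -(Z i j + z i j) := by simp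
      rw [this]
      exact neg_mem (add_mem (hZm i j) (hz i j))))
    simpa using this
  refine ⟨M0 + Y, 1 - (Z + z), ?_, hC, hfin⟩
  rw [Matrix.isUnit_iff_isUnit_det]
  apply D.unit _ M1.det
  · have h1 : D.φ (M0 + Y).det = N.det * (D.ψ.mapMatrix (1 - (Z + z))).det := by
      rw [AlgHom.map_det, ← hfin, Matrix.det_mul]
    rw [h1]
    refine IsUnit.mul ?_ ?_
    · exact IsUnit.of_mul_eq_one N'.det (by rw [← Matrix.det_mul, hNN, Matrix.det_one])
    · rw [← AlgHom.map_det]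
      exact ((Matrix.isUnit_iff_isUnit_det _).mp hC).map D.ψ
  · rw [← Matrix.det_mul]
    apply det_sub_one_mem
    intro i j
    have : ((M0 + Y) * M1 - 1) = (M0 * M1 - 1) + Y * M1 := by rw [add_mul]; abel
    rw [this]
    exact add_mem (hM i j) (mat_mul_mem_ideal' _ _ _ hYm i j)

/-! ### Unimodular and completable rows -/

theorem isUnimodular_iff {A : Type} [CommRing A] {n : ℕ} (v : Fin n → A) :
    IsUnimodular v ↔ ∃ w : Fin n → A, ∑ i, v i * w i = 1 := by
  rw [IsUnimodular, Ideal.eq_top_iff_one]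
  constructor
  · intro h
    obtain ⟨c, hc⟩ := (Submodule.mem_span_range_iff_exists_fun A).mp h
    exact ⟨c, by simpa [mul_comm] using hc⟩
  · rintro ⟨w, hw⟩
    exact (Submodule.mem_span_range_iff_exists_fun A).mpr ⟨w, by simpa [mul_comm] using hw⟩

theorem IsUnimodular.map' {A B : Type} [CommRing A] [CommRing B] {n : ℕ} {v : Fin n → A}
    (hv : IsUnimodular v) (f : A →+* B) : IsUnimodular (fun i => f (v i)) := by
  obtain ⟨w, hw⟩ := (isUnimodular_iff v).mp hv
  exact (isUnimodular_iff _).mpr ⟨fun i => f (w i), by simp only [← map_mul, ← map_sum, hw, map_one]⟩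

theorem isUnimodular_of_isUnit {A : Type} [CommRing A] {n : ℕ} (v w : Fin n → A)
    (h : IsUnit (∑ i, v i * w i)) : IsUnimodular v := by
  obtain ⟨e, he⟩ := h.exists_right_inv
  refine (isUnimodular_iff v).mpr ⟨fun i => w i * e, ?_⟩
  simp only [← mul_assoc, ← Finset.sum_mul, he]

theorem IsCompletable.of_vecMul {A : Type} [CommRing A] {n : ℕ} {v : Fin n → A}
    {M : Matrix (Fin n) (Fin n) A} (hM : IsUnit M) (h : IsCompletable (Matrix.vecMul v M)) :
    IsCompletable v := by
  obtain ⟨U, hU, i, hi⟩ := h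
  obtain ⟨M', hM'⟩ := hM.exists_right_inv
  have hM'u : IsUnit M' := IsUnit.of_mul_eq_one_right _ hM'
  refine ⟨U * M', hU.mul hM'u, i, ?_⟩
  rw [Matrix.mul_apply_eq_vecMul, hi, Matrix.vecMul_vecMul, hM', Matrix.vecMul_one]

theorem IsCompletable.exists_zero {A : Type} [CommRing A] {r : ℕ} {v : Fin (r + 1) → A}
    (h : IsCompletable v) : ∃ M : Matrix (Fin (r + 1)) (Fin (r + 1)) A, IsUnit M ∧ M 0 = v := by
  obtain ⟨U, hU, i, hi⟩ := h
  refine ⟨U.submatrix (Equiv.swap 0 i) (Equiv.refl _), ?_, ?_⟩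
  · rwa [Matrix.isUnit_submatrix_equiv]
  · rw [← hi]; ext j; simp

theorem IsCompletable.map' {A B : Type} [CommRing A] [CommRing B] {n : ℕ} {v : Fin n → A}
    (hv : IsCompletable v) (f : A →+* B) : IsCompletable (fun i => f (v i)) := by
  obtain ⟨U, hU, i, hi⟩ := hv
  refine ⟨f.mapMatrix U, hU.map _, i, ?_⟩
  ext j; simp [hi]

theorem isCompletable_of_isUnit {A : Type} [CommRing A] {n : ℕ} (v : Fin n → A) (i : Fin n)
    (h : IsUnit (v i)) : IsCompletable v := by
  refine ⟨(1 : Matrix (Fin n) (Fin n) A).updateRow i v, ?_, i, by simp⟩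
  rw [Matrix.isUnit_iff_isUnit_det, ← Matrix.cramer_transpose_apply]
  simpa using h

theorem IsCompletable.of_smul {A : Type} [CommRing A] {n : ℕ} {v : Fin n → A} (c : A)
    (hc : IsUnit c) (h : IsCompletable (fun i => c * v i)) : IsCompletable v := by
  apply IsCompletable.of_vecMul (M := Matrix.scalar (Fin n) c) (hc.map _)
  convert h using 1
  ext i
  simp [Matrix.vecMul_diagonal, mul_comm]

theorem IsCompletable.of_rank_one {A : Type} [CommRing A] {n : ℕ} {v : Fin n → A}
    (w u : Fin n → A) (hu : IsUnit (1 + ∑ i, u i * w i))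
    (h : IsCompletable (fun j => v j + (∑ i, v i * w i) * u j)) : IsCompletable v := by
  apply IsCompletable.of_vecMul (M := 1 + Matrix.vecMulVec w u)
  · rw [Matrix.isUnit_iff_isUnit_det]
    have : (1 + Matrix.vecMulVec w u).det = 1 + ∑ i, u i * w i := by
      rw [Matrix.vecMulVec_eq Unit, Matrix.det_one_add_replicateCol_mul_replicateRow]
      rfl
    rwa [this]
  · convert h using 1
    rw [Matrix.vecMul_add, Matrix.vecMul_one, Matrix.vecMul_vecMulVec]
    ext j
    simp [dotProduct]

theorem Rob.main {R A A' L : Type} [CommRing R] [IsLocalRing R] [CommRing A] [CommRing A']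
    [CommRing L] [Algebra R A] [Algebra R A'] [Algebra R L] (D : Rob R A A' L) {r : ℕ}
    (hLift : ∀ S T : Matrix (Fin (r + 1)) (Fin (r + 1)) L, (∀ i j, (S * T - 1) i j ∈ D.mL) →
      (∀ j, S 0 j - (1 : Matrix (Fin (r + 1)) (Fin (r + 1)) L) 0 j ∈ D.mL) →
      ∃ G : Matrix (Fin (r + 1)) (Fin (r + 1)) L, IsUnit G ∧
        G 0 = (1 : Matrix (Fin (r + 1)) (Fin (r + 1)) L) 0 ∧ ∀ i j, (S - G) i j ∈ D.mL)
    (v : Fin (r + 1) → A) (hv : IsUnimodular v)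
    (M0 M1 : Matrix (Fin (r + 1)) (Fin (r + 1)) A)
    (h01 : ∀ i j, (M0 * M1 - 1) i j ∈ (maximalIdeal R).map (algebraMap R A))
    (h10 : ∀ i j, (M1 * M0 - 1) i j ∈ (maximalIdeal R).map (algebraMap R A))
    (h1v : ∀ j, M1 0 j - v j ∈ (maximalIdeal R).map (algebraMap R A))
    (hcomp : IsCompletable (fun i => D.φ (v i))) : IsCompletable v := by
  have hφ : ∀ a ∈ (maximalIdeal R).map (algebraMap R A), D.φ a ∈ D.mL := by
    intro a ha
    apply D.map_le
    have := Ideal.mem_map_of_mem (D.φ : A →+* L) ha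
    rw [Ideal.map_map] at this
    rw [D.φ.comp_algebraMap] at this
    exact this
  obtain ⟨U, hU, hU0⟩ := hcomp.exists_zero
  obtain ⟨N0, hN0⟩ := hU.exists_right_inv
  have hN0' : N0 * U = 1 := mul_eq_one_comm.mp hN0
  obtain ⟨G, hG, hG0, hGS⟩ := hLift (D.φ.mapMatrix M1 * N0) (U * D.φ.mapMatrix M0) (by
      intro i j
      have : D.φ.mapMatrix M1 * N0 * (U * D.φ.mapMatrix M0) - 1 = D.φ.mapMatrix (M1 * M0 - 1) := by
        rw [mul_assoc, ← mul_assoc N0, hN0', one_mul, map_sub, map_mul, map_one]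
      rw [this]
      exact hφ _ (h10 i j)) (by
      intro j
      have h1 : (D.φ.mapMatrix M1 * N0) 0 j - (1 : Matrix (Fin (r + 1)) (Fin (r + 1)) L) 0 j
          = ∑ k, D.φ (M1 0 k - v k) * N0 k j := by
        rw [← hN0, Matrix.mul_apply, Matrix.mul_apply, hU0, ← Finset.sum_sub_distrib]
        refine Finset.sum_congr rfl fun k _ => ?_
        simp [sub_mul]
      rw [h1]
      exact Ideal.sum_mem _ fun k _ => Ideal.mul_mem_right _ _ (hφ _ (h1v k)))
  obtain ⟨G', hG'⟩ := hG.exists_right_inv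
  have hG'' : G' * G = 1 := mul_eq_one_comm.mp hG'
  obtain ⟨B, C, hB, hC, hBC⟩ := D.birk (N0 * G') (G * U)
    (by rw [mul_assoc, ← mul_assoc G', hG'', one_mul, hN0']) M0 M1 h01 (by
      have : N0 * G' - D.φ.mapMatrix M0 = D.φ.mapMatrix M0 * ((D.φ.mapMatrix M1 * N0 - G) * G')
          - D.φ.mapMatrix (M0 * M1 - 1) * (N0 * G') := by
        rw [sub_mul (D.φ.mapMatrix M1 * N0), hG', map_sub, map_mul, map_one, sub_mul, mul_sub]
        simp only [mul_assoc, mul_one, one_mul]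
        abel
      rw [this]
      intro i j
      exact sub_mem (mat_mul_mem_ideal _ _ _ (mat_mul_mem_ideal' _ _ _ hGS) i j)
        (mat_mul_mem_ideal' _ _ _ (fun i j => hφ _ (h01 i j)) i j))
  apply IsCompletable.of_vecMul hB
  have hrow : ∀ j, D.φ (Matrix.vecMul v B j) = D.ψ (C 0 j) := by
    intro j
    have h1 : D.φ (Matrix.vecMul v B j) = (U * D.φ.mapMatrix B) 0 j := by
      rw [Matrix.mul_apply, hU0]
      simp [Matrix.vecMul, dotProduct]
    rw [h1, ← hBC]
    simp only [← mul_assoc]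
    rw [hN0, one_mul]
    have h2 : G' 0 = (1 : Matrix (Fin (r + 1)) (Fin (r + 1)) L) 0 := by
      have := congrFun hG' 0
      rw [Matrix.mul_apply_eq_vecMul, hG0, ← Matrix.mul_apply_eq_vecMul, one_mul] at this
      exact this
    rw [Matrix.mul_apply_eq_vecMul, h2, ← Matrix.mul_apply_eq_vecMul, one_mul]
    rfl
  choose c hc using fun j => D.const _ _ (hrow j)
  have hcu : IsUnimodular c := by
    obtain ⟨w, hw⟩ := (isUnimodular_iff v).mp hv
    obtain ⟨B', hB'⟩ := hB.exists_right_inv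
    have h1 : ∑ i, Matrix.vecMul v B i * (Matrix.mulVec B' w) i = 1 := by
      change dotProduct _ _ = 1
      rw [← Matrix.dotProduct_mulVec, Matrix.mulVec_mulVec, hB', Matrix.one_mulVec]
      exact hw
    refine (isUnimodular_iff c).mpr ⟨fun i => D.ε (Matrix.mulVec B' w i), ?_⟩
    have := congrArg D.ε h1
    simpa [hc] using this
  have hcc : ∃ i, IsUnit (c i) := by
    by_contra hcon
    push Not at hcon
    obtain ⟨w, hw⟩ := (isUnimodular_iff c).mp hcu
    have : (1 : R) ∈ maximalIdeal R := by
      rw [← hw]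
      exact Ideal.sum_mem _ fun i _ => Ideal.mul_mem_right _ _ (hcon i)
    exact (Ideal.ne_top_iff_one _).mp (maximalIdeal.isMaximal R).ne_top this
  obtain ⟨i, hi⟩ := hcc
  apply isCompletable_of_isUnit _ i
  rw [hc]
  exact hi.map _

/-- Unimodular rows over a PID are completable. -/
theorem isCompletable_of_pid {B : Type} [CommRing B] [IsDomain B] [IsPrincipalIdealRing B] {n : ℕ}
    (v : Fin n → B) (hv : IsUnimodular v) : IsCompletable v := by
  obtain ⟨w, hw⟩ := (isUnimodular_iff v).mp hv
  have hv0 : v ≠ 0 := by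
    rintro rfl
    simp at hw
  obtain ⟨m, bM, bN, f, a, snf⟩ := Submodule.smithNormalForm (Pi.basisFun B (Fin n))
    (Submodule.span B {v})
  have hmem : v ∈ Submodule.span B {v} := Submodule.mem_span_singleton_self v
  have hsub : ∀ i j : Fin m, i = j := by
    intro i j
    by_contra hij
    obtain ⟨x, hx⟩ := Submodule.mem_span_singleton.mp (bN i).2
    obtain ⟨y, hy⟩ := Submodule.mem_span_singleton.mp (bN j).2
    have h1 : y • bN i - x • bN j = 0 := by
      apply Subtype.ext
      simp only [Submodule.coe_sub, Submodule.coe_smul, ← hx, ← hy, ZeroMemClass.coe_zero]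
      rw [smul_comm, sub_self]
    have h2 := congrArg (fun z => bN.repr z j) h1
    simp [hij] at h2
    rw [h2, zero_smul] at hx
    exact bN.ne_zero i (Subtype.ext hx.symm)
  have hm : ∃ i : Fin m, ∃ c : B, v = c • (bN i : Fin n → B) := by
    have h1 := congrArg Subtype.val (bN.sum_repr ⟨v, hmem⟩)
    rcases Nat.eq_zero_or_pos m with h0 | h0
    · subst h0
      simp at h1
      exact absurd h1.symm hv0
    · refine ⟨⟨0, h0⟩, bN.repr ⟨v, hmem⟩ ⟨0, h0⟩, ?_⟩
      rw [Finset.sum_eq_single (⟨0, h0⟩ : Fin m)] at h1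
      · exact h1.symm
      · intro b _ hb
        exact absurd (hsub _ _) hb
      · simp
  obtain ⟨i, c, hc⟩ := hm
  rw [snf, smul_smul] at hc
  have hu : IsUnit (c * a i) := by
    apply IsUnit.of_mul_eq_one (∑ k, bM (f i) k * w k)
    rw [← hw, Finset.mul_sum]
    refine Finset.sum_congr rfl fun k _ => ?_
    rw [hc]; simp [mul_assoc]
  have hbM : IsCompletable (bM (f i)) := by
    refine ⟨((Pi.basisFun B (Fin n)).toMatrix bM).transpose, ?_, f i, ?_⟩
    · rw [Matrix.isUnit_transpose]
      let _ := (Pi.basisFun B (Fin n)).invertibleToMatrix bM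
      exact isUnit_of_invertible _
    · ext k; simp [Module.Basis.toMatrix_apply]
  obtain ⟨e, he⟩ := hu.exists_left_inv
  apply IsCompletable.of_smul e (IsUnit.of_mul_eq_one _ he)
  convert hbM using 1
  ext k
  rw [hc]; simp [← mul_assoc]
  rw [mul_assoc e, he, one_mul]

/-- Reduction data for `Rob.main` from a surjection onto a PID. -/
theorem exists_red {A B : Type} [CommRing A] [CommRing B] [IsDomain B] [IsPrincipalIdealRing B]
    (π : A →+* B) (hπ : Function.Surjective π) (I : Ideal A) (hI : RingHom.ker π ≤ I) {r : ℕ}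
    (v : Fin (r + 1) → A) (hv : IsUnimodular v) :
    ∃ M0 M1 : Matrix (Fin (r + 1)) (Fin (r + 1)) A, (∀ i j, (M0 * M1 - 1) i j ∈ I) ∧
      (∀ i j, (M1 * M0 - 1) i j ∈ I) ∧ (∀ j, M1 0 j - v j ∈ I) := by
  obtain ⟨U, hU, hU0⟩ := (isCompletable_of_pid _ (hv.map' π)).exists_zero
  obtain ⟨U', hU'⟩ := hU.exists_right_inv
  have hU'' : U' * U = 1 := mul_eq_one_comm.mp hU'
  choose σ hσ using hπ
  have h1 : π.mapMatrix (U.map σ) = U := by ext i j; simp [hσ]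
  have h2 : π.mapMatrix (U'.map σ) = U' := by ext i j; simp [hσ]
  refine ⟨U'.map σ, U.map σ, ?_, ?_, ?_⟩
  · intro i j
    apply hI
    have : π.mapMatrix (U'.map σ * U.map σ - 1) = 0 := by
      rw [map_sub, map_mul, h1, h2, hU'', map_one, sub_self]
    exact congrFun (congrFun this i) j
  · intro i j
    apply hI
    have : π.mapMatrix (U.map σ * U'.map σ - 1) = 0 := by
      rw [map_sub, map_mul, h1, h2, hU', map_one, sub_self]
    exact congrFun (congrFun this i) j
  · intro j
    apply hI
    rw [RingHom.mem_ker, map_sub, sub_eq_zero]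
    simp [hσ, hU0]

/-! ### Laurent series -/

noncomputable instance lsAlg (R : Type) [CommRing R] :
    Algebra R (LaurentSeries R) := HahnSeries.instAlgebra

noncomputable def psiL (R : Type) [CommRing R] : PowerSeries R →ₐ[R] LaurentSeries R :=
  HahnSeries.ofPowerSeriesAlg ℤ R

noncomputable def phiL (R : Type) [CommRing R] : LaurentPolynomial R →ₐ[R] LaurentSeries R :=
  AddMonoidAlgebra.lift R (LaurentSeries R) ℤ
    { toFun n := HahnSeries.single n.toAdd 1
      map_one' := rfl
      map_mul' := fun a b => by simp [HahnSeries.single_mul_single] }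

noncomputable def polyL (R : Type) [CommRing R] : R[X] →ₐ[R] LaurentSeries R :=
  Polynomial.aeval (HahnSeries.single (-1) 1)

theorem psiL_coeff {R : Type} [CommRing R] (f : PowerSeries R) (n : ℤ) :
    (psiL R f).coeff n = if n < 0 then 0 else PowerSeries.coeff n.natAbs f :=
  PowerSeries.coeff_coe f n

theorem lsAlg_apply {R : Type} [CommRing R] (c : R) :
    algebraMap R (LaurentSeries R) c = HahnSeries.single 0 c := rfl

theorem phiL_T {R : Type} [CommRing R] (n : ℤ) :
    phiL R (LaurentPolynomial.T n) = HahnSeries.single n 1 := by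
  unfold phiL LaurentPolynomial.T
  rw [AddMonoidAlgebra.lift_single, one_smul]
  rfl

theorem phiL_C {R : Type} [CommRing R] (c : R) :
    phiL R (LaurentPolynomial.C c) = HahnSeries.single 0 c := by
  have := (phiL R).commutes c
  rw [lsAlg_apply] at this
  rw [← this]; rfl

theorem phiL_coeff {R : Type} [CommRing R] (p : LaurentPolynomial R) (n : ℤ) :
    (phiL R p).coeff n = p.coeff n := by
  induction p using LaurentPolynomial.induction_on' with
  | add p q hp hq => simp [hp, hq]
  | C_mul_T m a =>
    rw [map_mul, phiL_C, phiL_T, HahnSeries.single_mul_single, ← LaurentPolynomial.single_eq_C_mul_T,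
      AddMonoidAlgebra.coeff_single, Finsupp.single_apply, HahnSeries.coeff_single]
    simp [eq_comm]

theorem polyL_coeff {R : Type} [CommRing R] (p : R[X]) (n : ℤ) :
    (polyL R p).coeff n = if n ≤ 0 then p.coeff n.natAbs else 0 := by
  induction p using Polynomial.induction_on' with
  | add p q hp hq => simp only [map_add, HahnSeries.coeff_add, hp, hq, Polynomial.coeff_add]; split_ifs <;> simp
  | monomial m a =>
    unfold polyL
    rw [Polynomial.aeval_monomial, HahnSeries.single_pow, lsAlg_apply, HahnSeries.single_mul_single,
      HahnSeries.coeff_single, Polynomial.coeff_monomial]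
    simp
    split_ifs <;> first | rfl | omega

theorem polyL_eq {R : Type} [CommRing R] (p : R[X]) :
    polyL R p = phiL R (LaurentPolynomial.invert (Polynomial.toLaurent p)) := by
  have : polyL R = (phiL R).comp ((LaurentPolynomial.invert (R := R)).toAlgHom.comp
      Polynomial.toLaurentAlg) := by
    apply Polynomial.algHom_ext
    simp [polyL, phiL_T]
  rw [this]; simp

theorem psiL_X_pow {R : Type} [CommRing R] (n : ℕ) :
    psiL R (PowerSeries.X ^ n) = HahnSeries.single (n : ℤ) 1 :=
  HahnSeries.ofPowerSeries_X_pow n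

theorem psiL_inj {R : Type} [CommRing R] : Function.Injective (psiL R) :=
  HahnSeries.ofPowerSeries_injective

/-- bounded poles -/
theorem ls_bdd {R : Type} [CommRing R] (x : LaurentSeries R) :
    ∃ K : ℕ, ∃ a, psiL R (PowerSeries.X ^ K) * x = psiL R a := by
  have hx : ∃ K : ℕ, ∀ n : ℤ, n < -K → x.coeff n = 0 := by
    refine ⟨(x.order).natAbs, fun n hn => HahnSeries.coeff_eq_zero_of_lt_order ?_⟩
    omega
  obtain ⟨K, hK⟩ := hx
  refine ⟨K, PowerSeries.mk fun n => x.coeff ((n : ℤ) - K), ?_⟩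
  ext n
  rw [psiL_X_pow, HahnSeries.coeff_single_mul, psiL_coeff, one_mul]
  split_ifs with h
  · exact hK _ (by omega)
  · rw [PowerSeries.coeff_mk]; congr 2; omega

theorem ls_dec {R : Type} [CommRing R] (x : LaurentSeries R) :
    ∃ (p : R[X]) (z : PowerSeries R), x = polyL R p + psiL R z ∧
      (∀ i : ℕ, p.coeff i = x.coeff (-i)) ∧
      (∀ i : ℕ, PowerSeries.coeff i z = if i = 0 then 0 else x.coeff i) := by
  obtain ⟨K, a, ha⟩ := ls_bdd x
  have hK : ∀ n : ℤ, n < -K → x.coeff n = 0 := by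
    intro n hn
    have := congrArg (fun y => HahnSeries.coeff y (n + K)) ha
    rw [psiL_X_pow, HahnSeries.coeff_single_mul, psiL_coeff, one_mul, if_pos (by omega)] at this
    simpa using this
  have hp : ∀ i : ℕ, (∑ j ∈ Finset.range (K + 1),
      Polynomial.monomial j (x.coeff (-(j : ℤ)))).coeff i = x.coeff (-i) := by
    intro i
    rw [Polynomial.finsetSum_coeff]
    simp only [Polynomial.coeff_monomial, Finset.sum_ite_eq', Finset.mem_range]
    split_ifs with h
    · rfl
    · exact (hK _ (by omega)).symm
  refine ⟨_, PowerSeries.mk fun i => if i = 0 then 0 else x.coeff i, ?_, hp, by simp⟩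
  ext n
  rw [HahnSeries.coeff_add, polyL_coeff, psiL_coeff, hp, PowerSeries.coeff_mk]
  rcases lt_trichotomy n 0 with h | h | h
  · rw [if_pos h.le, if_pos h, add_zero]; congr 1; omega
  · subst h; simp
  · rw [if_neg (by omega), if_neg (by omega), if_neg (by omega), zero_add]; congr 1; omega

/-! ### Lifting invertible matrices -/

def HLift (L : Type) [CommRing L] (I : Ideal L) (r : ℕ) : Prop :=
  ∀ S T : Matrix (Fin (r + 1)) (Fin (r + 1)) L, (∀ i j, (S * T - 1) i j ∈ I) →
      (∀ j, S 0 j - (1 : Matrix (Fin (r + 1)) (Fin (r + 1)) L) 0 j ∈ I) →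
      ∃ G : Matrix (Fin (r + 1)) (Fin (r + 1)) L, IsUnit G ∧
        G 0 = (1 : Matrix (Fin (r + 1)) (Fin (r + 1)) L) 0 ∧ ∀ i j, (S - G) i j ∈ I

theorem isMaximal_of_unit_lift {L : Type} [CommRing L] (I : Ideal L) (hI : I ≠ ⊤)
    (hU : ∀ x, x ∉ I → ∃ u, IsUnit u ∧ x - u ∈ I) : I.IsMaximal := by
  rw [Ideal.isMaximal_iff]
  refine ⟨fun h => hI ((Ideal.eq_top_iff_one I).mpr h), fun J x hJ hx hxJ => ?_⟩
  obtain ⟨u, hu, hxu⟩ := hU x hx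
  have : u ∈ J := by
    have := J.sub_mem hxJ (hJ hxu)
    simpa using this
  rw [← Ideal.eq_top_iff_one]
  exact Ideal.eq_top_of_isUnit_mem J this hu

theorem lift_matrix {L : Type} [CommRing L] (I : Ideal L) (hI : I ≠ ⊤)
    (hU : ∀ x, x ∉ I → ∃ u, IsUnit u ∧ x - u ∈ I) {n : ℕ}
    (M : Matrix (Fin n) (Fin n) (L ⧸ I)) (hM : IsUnit M) :
    ∃ G : Matrix (Fin n) (Fin n) L, IsUnit G ∧ (Ideal.Quotient.mk I).mapMatrix G = M := by
  have hmax := isMaximal_of_unit_lift I hI hU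
  let _ : Field (L ⧸ I) := Ideal.Quotient.field I
  have hdet : M.det ≠ 0 := ((Matrix.isUnit_iff_isUnit_det M).mp hM).ne_zero
  refine Matrix.diagonal_transvection_induction_of_det_ne_zero
    (fun M => ∃ G : Matrix (Fin n) (Fin n) L, IsUnit G ∧ (Ideal.Quotient.mk I).mapMatrix G = M)
    M hdet ?_ ?_ ?_
  · intro D hD
    rw [Matrix.det_diagonal] at hD
    have hD' := fun i => Finset.prod_ne_zero_iff.mp hD i (Finset.mem_univ i)
    have : ∀ i, ∃ u : L, IsUnit u ∧ Ideal.Quotient.mk I u = D i := by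
      intro i
      obtain ⟨x, hx⟩ := Ideal.Quotient.mk_surjective (D i)
      have hxI : x ∉ I := fun h => hD' i (by rw [← hx]; exact Ideal.Quotient.eq_zero_iff_mem.mpr h)
      obtain ⟨u, hu, hxu⟩ := hU x hxI
      exact ⟨u, hu, by rw [← hx]; exact ((Ideal.Quotient.mk_eq_mk_iff_sub_mem _ _).mpr hxu).symm⟩
    choose u hu hu2 using this
    refine ⟨Matrix.diagonal u, ?_, ?_⟩
    · rw [Matrix.isUnit_iff_isUnit_det, Matrix.det_diagonal]
      exact IsUnit.prod_univ_iff.mpr hu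
    · ext i j
      by_cases h : i = j
      · subst h; simp [hu2]
      · simp [h]
  · rintro ⟨i, j, hij, c⟩
    obtain ⟨x, hx⟩ := Ideal.Quotient.mk_surjective c
    refine ⟨Matrix.transvection i j x, ?_, ?_⟩
    · rw [Matrix.isUnit_iff_isUnit_det, Matrix.det_transvection_of_ne i j hij]
      exact isUnit_one
    · simp only [Matrix.TransvectionStruct.toMatrix, Matrix.transvection, map_add, map_one]
      congr 1
      ext a b
      simp only [RingHom.mapMatrix_apply, Matrix.map_apply, Matrix.single_apply]
      split_ifs <;> simp [hx]
  · rintro A B _ _ ⟨G, hG, rfl⟩ ⟨H, hH, rfl⟩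
    exact ⟨G * H, hG.mul hH, map_mul _ _ _⟩

theorem hLift_of_unit_lift {L : Type} [CommRing L] (I : Ideal L) (hI : I ≠ ⊤)
    (hU : ∀ x, x ∉ I → ∃ u, IsUnit u ∧ x - u ∈ I) (r : ℕ) : HLift L I r := by
  intro S T hST hS0
  let π := Ideal.Quotient.mk I
  have hST' : π.mapMatrix S * π.mapMatrix T = 1 := by
    rw [← map_mul, ← map_one π.mapMatrix]
    ext i j
    exact (Ideal.Quotient.mk_eq_mk_iff_sub_mem _ _).mpr (hST i j)
  have hS0' : ∀ j, π.mapMatrix S 0 j = (1 : Matrix (Fin (r + 1)) (Fin (r + 1)) (L ⧸ I)) 0 j := by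
    intro j
    rw [← map_one π.mapMatrix]
    exact (Ideal.Quotient.mk_eq_mk_iff_sub_mem _ _).mpr (hS0 j)
  have key : ∀ {B : Type} [CommRing B] (N : Matrix (Fin (r + 1)) (Fin (r + 1)) B),
      (∀ j, N 0 j = (1 : Matrix (Fin (r + 1)) (Fin (r + 1)) B) 0 j) →
      N.det = (N.submatrix Fin.succ Fin.succ).det := by
    intro B _ N hN
    rw [Matrix.det_succ_row_zero, Finset.sum_eq_single 0]
    · simp [hN]
    · intro j _ hj
      rw [hN, Matrix.one_apply_ne hj.symm]; simp
    · simp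
  have hunit : IsUnit (π.mapMatrix S) := IsUnit.of_mul_eq_one _ hST'
  have hD : IsUnit ((π.mapMatrix S).submatrix Fin.succ Fin.succ) := by
    rw [Matrix.isUnit_iff_isUnit_det, ← key _ hS0', ← Matrix.isUnit_iff_isUnit_det]
    exact hunit
  obtain ⟨D, hDu, hD2⟩ := lift_matrix I hI hU _ hD
  let G : Matrix (Fin (r + 1)) (Fin (r + 1)) L :=
    Fin.cons ((1 : Matrix (Fin (r + 1)) (Fin (r + 1)) L) 0)
      (fun i => Fin.cons (S i.succ 0) (D i))
  have hG0 : G 0 = (1 : Matrix (Fin (r + 1)) (Fin (r + 1)) L) 0 := rfl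
  refine ⟨G, ?_, hG0, ?_⟩
  · rw [Matrix.isUnit_iff_isUnit_det, key G (fun j => by rw [hG0])]
    have : G.submatrix Fin.succ Fin.succ = D := by
      ext i j; rfl
    rwa [this, ← Matrix.isUnit_iff_isUnit_det]
  · intro i j
    refine Fin.cases ?_ (fun i => ?_) i
    · exact hS0 j
    · refine Fin.cases ?_ (fun j => ?_) j
      · change S i.succ 0 - S i.succ 0 ∈ I
        simp
      · change S i.succ j.succ - D i j ∈ I
        have := congrFun (congrFun hD2 i) j
        exact (Ideal.Quotient.mk_eq_mk_iff_sub_mem _ _).mp this.symm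

/-- Combining matrices. -/
def matProd {A B : Type} {n : ℕ} (M : Matrix (Fin n) (Fin n) A) (N : Matrix (Fin n) (Fin n) B) :
    Matrix (Fin n) (Fin n) (A × B) := fun i j => (M i j, N i j)

theorem matProd_mul {A B : Type} [CommRing A] [CommRing B] {n : ℕ}
    (M M' : Matrix (Fin n) (Fin n) A) (N N' : Matrix (Fin n) (Fin n) B) :
    matProd M N * matProd M' N' = matProd (M * M') (N * N') := by
  ext i j <;> simp [matProd, Matrix.mul_apply, Prod.fst_sum, Prod.snd_sum]

theorem matProd_one {A B : Type} [CommRing A] [CommRing B] {n : ℕ} :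
    matProd (1 : Matrix (Fin n) (Fin n) A) (1 : Matrix (Fin n) (Fin n) B) = 1 := by
  ext i j <;> by_cases h : i = j <;> simp [matProd, h, Matrix.one_apply]

theorem matProd_isUnit {A B : Type} [CommRing A] [CommRing B] {n : ℕ}
    {M : Matrix (Fin n) (Fin n) A} {N : Matrix (Fin n) (Fin n) B} (hM : IsUnit M)
    (hN : IsUnit N) : IsUnit (matProd M N) := by
  obtain ⟨M', hM'⟩ := hM.exists_right_inv
  obtain ⟨N', hN'⟩ := hN.exists_right_inv
  exact IsUnit.of_mul_eq_one (matProd M' N') (by rw [matProd_mul, hM', hN', matProd_one])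

theorem ideal_mem_prod {A B : Type} [CommRing A] [CommRing B] {I : Ideal A} {J : Ideal B}
    {x : A × B} : x ∈ I.prod J ↔ x.1 ∈ I ∧ x.2 ∈ J := Iff.rfl

theorem HLift.prod {A B : Type} [CommRing A] [CommRing B] {I : Ideal A} {J : Ideal B} {r : ℕ}
    (hA : HLift A I r) (hB : HLift B J r) : HLift (A × B) (I.prod J) r := by
  intro S T hST hS0
  have e1 : ∀ i j, ((1 : Matrix (Fin (r + 1)) (Fin (r + 1)) (A × B)) i j).1 =
      (1 : Matrix (Fin (r + 1)) (Fin (r + 1)) A) i j := by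
    intro i j; by_cases h : i = j <;> simp [h, Matrix.one_apply]
  have e2 : ∀ i j, ((1 : Matrix (Fin (r + 1)) (Fin (r + 1)) (A × B)) i j).2 =
      (1 : Matrix (Fin (r + 1)) (Fin (r + 1)) B) i j := by
    intro i j; by_cases h : i = j <;> simp [h, Matrix.one_apply]
  obtain ⟨G, hG, hG0, hG1⟩ := hA (S.map Prod.fst) (T.map Prod.fst)
    (fun i j => by
      have := (ideal_mem_prod.mp (hST i j)).1
      simpa [Matrix.mul_apply, Prod.fst_sum, e1] using this)
    (fun j => by
      have := (ideal_mem_prod.mp (hS0 j)).1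
      simpa [e1] using this)
  obtain ⟨H, hH, hH0, hH1⟩ := hB (S.map Prod.snd) (T.map Prod.snd)
    (fun i j => by
      have := (ideal_mem_prod.mp (hST i j)).2
      simpa [Matrix.mul_apply, Prod.snd_sum, e2] using this)
    (fun j => by
      have := (ideal_mem_prod.mp (hS0 j)).2
      simpa [e2] using this)
  refine ⟨matProd G H, matProd_isUnit hG hH, ?_, fun i j => ideal_mem_prod.mpr ⟨hG1 i j, hH1 i j⟩⟩
  rw [← matProd_one]
  ext j
  · exact congrFun hG0 j
  · exact congrFun hH0 j

theorem IsCompletable.prod {A B : Type} [CommRing A] [CommRing B] {r : ℕ}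
    {v : Fin (r + 1) → A} {w : Fin (r + 1) → B} (hv : IsCompletable v) (hw : IsCompletable w) :
    IsCompletable (fun i => (v i, w i)) := by
  obtain ⟨G, hG, hG0⟩ := hv.exists_zero
  obtain ⟨H, hH, hH0⟩ := hw.exists_zero
  refine ⟨matProd G H, matProd_isUnit hG hH, 0, ?_⟩
  ext j
  · exact congrFun hG0 j
  · exact congrFun hH0 j

/-! ### The ideal of Laurent series with coefficients in `m` -/

def mLs (R : Type) [CommRing R] [IsLocalRing R] : Ideal (LaurentSeries R) where
  carrier := {x | ∀ n, x.coeff n ∈ maximalIdeal R}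
  add_mem' := fun ha hb n => by
    rw [HahnSeries.coeff_add]; exact add_mem (ha n) (hb n)
  zero_mem' := fun n => by simp
  smul_mem' := fun c x hx n => by
    rw [smul_eq_mul, HahnSeries.coeff_mul]
    exact sum_mem fun ij _ => Ideal.mul_mem_left _ _ (hx _)

theorem mem_mLs {R : Type} [CommRing R] [IsLocalRing R] {x : LaurentSeries R} :
    x ∈ mLs R ↔ ∀ n, x.coeff n ∈ maximalIdeal R := Iff.rfl

theorem isUnit_psiL_X_pow {R : Type} [CommRing R] (n : ℕ) :
    IsUnit (psiL R (PowerSeries.X ^ n)) := by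
  apply IsUnit.of_mul_eq_one (HahnSeries.single (-(n : ℤ)) 1)
  rw [psiL_X_pow, HahnSeries.single_mul_single]
  simp

theorem mLs_ne_top {R : Type} [CommRing R] [IsLocalRing R] : mLs R ≠ ⊤ := by
  intro h
  have h1 := (Ideal.eq_top_iff_one _).mp h 0
  rw [HahnSeries.coeff_one, if_pos rfl] at h1
  exact (Ideal.ne_top_iff_one _).mp (maximalIdeal.isMaximal R).ne_top h1

theorem mLs_unit_lift {R : Type} [CommRing R] [IsLocalRing R] (x : LaurentSeries R)
    (hx : x ∉ mLs R) : ∃ u, IsUnit u ∧ x - u ∈ mLs R := by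
  classical
  obtain ⟨K, a, ha⟩ := ls_bdd x
  obtain ⟨y, hy⟩ := (isUnit_psiL_X_pow (R := R) K).exists_right_inv
  have hxa : x = y * psiL R a := by
    rw [← ha, ← mul_assoc, mul_comm y, hy, one_mul]
  have hex : ∃ j, PowerSeries.coeff j a ∉ maximalIdeal R := by
    by_contra! hcon
    apply hx
    rw [hxa]
    apply Ideal.mul_mem_left
    intro n
    rw [psiL_coeff]
    split_ifs
    · exact zero_mem _
    · exact hcon _
  let j := Nat.find hex
  have hj : PowerSeries.coeff j a ∉ maximalIdeal R := Nat.find_spec hex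
  have hlt : ∀ i < j, PowerSeries.coeff i a ∈ maximalIdeal R := fun i hi => by
    have := Nat.find_min hex hi
    simpa using this
  let u : PowerSeries R := PowerSeries.mk fun i => PowerSeries.coeff (i + j) a
  have hu : IsUnit u := by
    rw [PowerSeries.isUnit_iff_constantCoeff]
    have : PowerSeries.constantCoeff u = PowerSeries.coeff j a := by
      rw [← PowerSeries.coeff_zero_eq_constantCoeff_apply, PowerSeries.coeff_mk, zero_add]
    rw [this]
    simpa using hj
  refine ⟨y * (psiL R (PowerSeries.X ^ j * u)), ?_, ?_⟩
  · rw [map_mul]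
    exact (IsUnit.of_mul_eq_one_right _ hy).mul ((isUnit_psiL_X_pow j).mul (hu.map _))
  · rw [hxa, ← mul_sub, ← map_sub]
    apply Ideal.mul_mem_left
    intro n
    rw [psiL_coeff]
    split_ifs
    · exact zero_mem _
    · rw [map_sub, PowerSeries.coeff_X_pow_mul']
      split_ifs with h
      · rw [PowerSeries.coeff_mk, Nat.sub_add_cancel h, sub_self]; exact zero_mem _
      · rw [sub_zero]; exact hlt _ (by omega)

theorem hLift_mLs {R : Type} [CommRing R] [IsLocalRing R] (r : ℕ) :
    HLift (LaurentSeries R) (mLs R) r :=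
  hLift_of_unit_lift _ mLs_ne_top mLs_unit_lift r

/-! ### The one-sided set-up -/

noncomputable def mPs (R : Type) [CommRing R] [IsLocalRing R] : Ideal (PowerSeries R) := (mLs R).comap (psiL R)

theorem ls_unit_add {R : Type} [CommRing R] [IsLocalRing R] (z : PowerSeries R) (hz : z ∈ mPs R) :
    IsUnit (1 + z) := by
  rw [PowerSeries.isUnit_iff_constantCoeff]
  have h0 := (hz : psiL R z ∈ mLs R) 0
  rw [psiL_coeff, if_neg (by omega), Int.natAbs_zero,
    PowerSeries.coeff_zero_eq_constantCoeff_apply] at h0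
  rw [map_add, map_one]
  by_contra h
  have h2 : (1 + PowerSeries.constantCoeff z) ∈ maximalIdeal R := h
  have h3 := sub_mem h2 h0
  rw [add_sub_cancel_right] at h3
  exact (Ideal.ne_top_iff_one _).mp (maximalIdeal.isMaximal R).ne_top h3

theorem ls_map_le (R : Type) [CommRing R] [IsLocalRing R] :
    (maximalIdeal R).map (algebraMap R (LaurentSeries R)) ≤ mLs R := by
  rw [Ideal.map_le_iff_le_comap]
  intro c hc n
  rw [lsAlg_apply, HahnSeries.coeff_single]
  split_ifs
  · exact hc
  · exact zero_mem _

theorem ls_map_le' (R : Type) [CommRing R] [IsLocalRing R] :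
    (maximalIdeal R).map (algebraMap R (PowerSeries R)) ≤ mPs R := by
  rw [Ideal.map_le_iff_le_comap]
  intro c hc
  change psiL R (algebraMap R _ c) ∈ mLs R
  rw [AlgHom.commutes]
  exact ls_map_le R (Ideal.mem_map_of_mem _ hc)

theorem ls_mL_dec {R : Type} [CommRing R] [IsLocalRing R] (x : LaurentSeries R) (hx : x ∈ mLs R) :
    ∃ y ∈ (maximalIdeal R) • (⊤ : Submodule R (LaurentSeries R)), ∃ z ∈ mPs R,
      x = y + psiL R z := by
  obtain ⟨p, z, hpz, hp, hz⟩ := ls_dec x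
  refine ⟨polyL R p, ?_, z, ?_, hpz⟩
  · rw [Ideal.smul_top_eq_map]
    have h1 : p ∈ (maximalIdeal R).map (algebraMap R R[X]) := by
      rw [Polynomial.algebraMap_eq, Ideal.mem_map_C_iff]
      intro n
      rw [hp]; exact hx _
    have h2 := Ideal.mem_map_of_mem (polyL R : R[X] →+* LaurentSeries R) h1
    rw [Ideal.map_map, AlgHom.comp_algebraMap] at h2
    exact h2
  · intro n
    rw [psiL_coeff]
    split_ifs
    · exact zero_mem _
    · rw [hz]
      split_ifs
      · exact zero_mem _
      · exact hx _

theorem ls_fin1 {R : Type} [CommRing R] (K : ℕ) :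
    ∃ V : Submodule R (PowerSeries R), V.FG ∧
      ∀ a', ∃ a'', a' - PowerSeries.X ^ K * a'' ∈ V := by
  refine ⟨Submodule.span R (Set.range fun i : Fin K => (PowerSeries.X ^ (i : ℕ) : PowerSeries R)),
    Submodule.fg_span (Set.finite_range _), fun a => ?_⟩
  let b : PowerSeries R := ∑ i : Fin K, (PowerSeries.coeff (i : ℕ) a) • PowerSeries.X ^ (i : ℕ)
  have hb : PowerSeries.X ^ K ∣ a - b := by
    rw [PowerSeries.X_pow_dvd_iff]
    intro m hm
    rw [map_sub, map_sum, Finset.sum_eq_single ⟨m, hm⟩]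
    · simp
    · intro j _ hj
      rw [PowerSeries.coeff_smul, PowerSeries.coeff_X_pow, if_neg, smul_zero]
      rintro rfl
      exact hj rfl
    · simp
  obtain ⟨c, hc⟩ := hb
  refine ⟨c, ?_⟩
  rw [← hc, sub_sub_cancel]
  exact Submodule.sum_mem _ fun i _ => Submodule.smul_mem _ _ (Submodule.subset_span ⟨i, rfl⟩)

theorem span_X_pow_mem {R : Type} [CommRing R] (n : ℕ) (a : R[X]) (ha : ∀ i, n ≤ i → a.coeff i = 0) :
    a ∈ Submodule.span R (Set.range fun i : Fin n => (X ^ (i : ℕ) : R[X])) := by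
  have : a = ∑ i : Fin n, a.coeff i • X ^ (i : ℕ) := by
    ext m
    rw [Polynomial.finsetSum_coeff]
    simp only [Polynomial.coeff_smul, Polynomial.coeff_X_pow, smul_eq_mul, mul_ite, mul_one, mul_zero]
    by_cases hm : m < n
    · rw [Finset.sum_eq_single ⟨m, hm⟩]
      · simp
      · intro j _ hj
        rw [if_neg]
        rintro rfl
        exact hj rfl
      · simp
    · rw [ha m (by omega), Finset.sum_eq_zero]
      intro i _
      rw [if_neg]
      have := i.2
      omega
  rw [this]
  exact Submodule.sum_mem _ fun i _ => Submodule.smul_mem _ _ (Submodule.subset_span ⟨i, rfl⟩)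

/-- coefficients of negative index vanish -/
theorem coeff_of_X_pow_mul {R : Type} [CommRing R] {K : ℕ} {x : LaurentSeries R} {a : PowerSeries R}
    (h : psiL R (PowerSeries.X ^ K) * x = psiL R a) (n : ℤ) (hn : n < -K) : x.coeff n = 0 := by
  have := congrArg (fun y => HahnSeries.coeff y (n + K)) h
  rw [psiL_X_pow, HahnSeries.coeff_single_mul, psiL_coeff, one_mul, if_pos (by omega)] at this
  simpa using this

noncomputable def rob1 (R : Type) [CommRing R] [IsLocalRing R] :
    Rob R R[X] (PowerSeries R) (LaurentSeries R) where
  φ := polyL R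
  ψ := psiL R
  mL := mLs R
  mA' := mPs R
  unit_add := ls_unit_add
  map_le' := ls_map_le' R
  map_le := ls_map_le R
  mL_dec := ls_mL_dec
  dec := fun x => by
    obtain ⟨p, z, h, _⟩ := ls_dec x
    exact ⟨p, z, h⟩
  τ := PowerSeries.X
  bdd := ls_bdd
  fin1 := ls_fin1
  fin2 := fun K => by
    refine ⟨Submodule.span R (Set.range fun i : Fin (K + 1) => (X ^ (i : ℕ) : R[X])),
      Submodule.fg_span (Set.finite_range _), fun a a' h => ?_⟩
    apply span_X_pow_mem
    intro i hi
    have := coeff_of_X_pow_mul h (-i) (by omega)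
    rw [polyL_coeff, if_pos (by omega)] at this
    simpa using this
  const := fun a a' h => by
    refine ⟨a.coeff 0, ?_⟩
    ext i
    rw [Polynomial.algebraMap_eq, Polynomial.coeff_C]
    split_ifs with hi
    · rw [hi]
    · have := coeff_of_X_pow_mul (K := 0) (x := polyL R a) (a := a') (by rw [pow_zero, map_one, one_mul, h]) (-i) (by omega)
      rw [polyL_coeff, if_pos (by omega)] at this
      simpa using this
  ε := Polynomial.aeval 1

/-! ### The two-sided set-up -/

noncomputable def phi2 (R : Type) [CommRing R] :
    LaurentPolynomial R →ₐ[R] LaurentSeries R × LaurentSeries R :=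
  AlgHom.prod ((phiL R).comp (LaurentPolynomial.invert (R := R)).toAlgHom) (phiL R)

noncomputable def psi2 (R : Type) [CommRing R] :
    PowerSeries R × PowerSeries R →ₐ[R] LaurentSeries R × LaurentSeries R :=
  AlgHom.prodMap (psiL R) (psiL R)

theorem phi2_fst {R : Type} [CommRing R] (a : LaurentPolynomial R) :
    (phi2 R a).1 = phiL R (LaurentPolynomial.invert a) := rfl
theorem phi2_snd {R : Type} [CommRing R] (a : LaurentPolynomial R) :
    (phi2 R a).2 = phiL R a := rfl
theorem psi2_fst {R : Type} [CommRing R] (a : PowerSeries R × PowerSeries R) :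
    (psi2 R a).1 = psiL R a.1 := rfl
theorem psi2_snd {R : Type} [CommRing R] (a : PowerSeries R × PowerSeries R) :
    (psi2 R a).2 = psiL R a.2 := rfl

theorem phiL_toLaurent {R : Type} [CommRing R] (p : R[X]) :
    phiL R (Polynomial.toLaurent p) = psiL R (p : PowerSeries R) := by
  have : (phiL R).comp Polynomial.toLaurentAlg =
      (psiL R).comp (Polynomial.coeToPowerSeries.algHom R) := by
    apply Polynomial.algHom_ext
    have := psiL_X_pow (R := R) 1
    rw [pow_one] at this
    simp [phiL_T, this]
  have := DFunLike.congr_fun this p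
  simpa using this

theorem laurent_dec {R : Type} [CommRing R] (x : LaurentSeries R × LaurentSeries R) :
    ∃ a a', x = phi2 R a + psi2 R a' := by
  obtain ⟨p, z, h, _⟩ := ls_dec x.1
  obtain ⟨q, w, h', _⟩ := ls_dec x.2
  refine ⟨Polynomial.toLaurent p + LaurentPolynomial.invert (Polynomial.toLaurent q),
    (z - (q : PowerSeries R), w - (p : PowerSeries R)), ?_⟩
  ext1
  · rw [Prod.fst_add, phi2_fst, psi2_fst, h]
    simp only [map_add, map_sub]
    have : LaurentPolynomial.invert (LaurentPolynomial.invert (Polynomial.toLaurent q)) =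
      Polynomial.toLaurent q := by ext n; simp
    rw [this, ← polyL_eq, phiL_toLaurent]
    ring
  · rw [Prod.snd_add, phi2_snd, psi2_snd, h']
    simp only [map_add, map_sub]
    rw [← polyL_eq, phiL_toLaurent]
    ring

theorem laurent_span_mem {R : Type} [CommRing R] (K : ℕ) (a : LaurentPolynomial R)
    (h1 : ∀ n : ℤ, n < -K → a.coeff n = 0) (h2 : ∀ n : ℤ, (K : ℤ) < n → a.coeff n = 0) :
    a ∈ Submodule.span R (Set.range fun i : Fin (2 * K + 1) =>
      (LaurentPolynomial.T ((i : ℤ) - K) : LaurentPolynomial R)) := by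
  rw [← AddMonoidAlgebra.sum_coeff_single a, Finsupp.sum]
  refine Submodule.sum_mem _ fun n hn => ?_
  have hn' := Finsupp.mem_support_iff.mp hn
  have ha : -(K : ℤ) ≤ n := by
    by_contra h
    exact hn' (h1 n (by omega))
  have hb : n ≤ K := by
    by_contra h
    exact hn' (h2 n (by omega))
  rw [LaurentPolynomial.single_eq_C_mul_T, ← LaurentPolynomial.smul_eq_C_mul]
  refine Submodule.smul_mem _ _ (Submodule.subset_span ⟨⟨(n + K).toNat, by omega⟩, ?_⟩)
  simp only
  congr 1
  omega

noncomputable def rob2 (R : Type) [CommRing R] [IsLocalRing R] :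
    Rob R (LaurentPolynomial R) (PowerSeries R × PowerSeries R)
      (LaurentSeries R × LaurentSeries R) where
  φ := phi2 R
  ψ := psi2 R
  mL := (mLs R).prod (mLs R)
  mA' := (mPs R).prod (mPs R)
  unit_add := fun z hz => by
    rw [Prod.isUnit_iff]
    exact ⟨ls_unit_add _ hz.1, ls_unit_add _ hz.2⟩
  map_le' := by
    rw [Ideal.map_le_iff_le_comap]
    intro c hc
    exact ⟨ls_map_le' R (Ideal.mem_map_of_mem _ hc), ls_map_le' R (Ideal.mem_map_of_mem _ hc)⟩
  map_le := by
    rw [Ideal.map_le_iff_le_comap]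
    intro c hc
    exact ⟨ls_map_le R (Ideal.mem_map_of_mem _ hc), ls_map_le R (Ideal.mem_map_of_mem _ hc)⟩
  mL_dec := fun x hx => by
    obtain ⟨y, hy, z, hz, h⟩ := ls_mL_dec x.1 hx.1
    obtain ⟨y', hy', z', hz', h'⟩ := ls_mL_dec x.2 hx.2
    refine ⟨(y, y'), ?_, (z, z'), ⟨hz, hz'⟩, Prod.ext h h'⟩
    have e1 := Submodule.mem_map_of_mem (f := LinearMap.inl R (LaurentSeries R) (LaurentSeries R)) hy
    have e2 := Submodule.mem_map_of_mem (f := LinearMap.inr R (LaurentSeries R) (LaurentSeries R)) hy'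
    rw [Submodule.map_smul''] at e1 e2
    have := add_mem (Submodule.smul_mono le_rfl le_top e1) (Submodule.smul_mono le_rfl le_top e2)
    simpa using this
  dec := laurent_dec
  τ := (PowerSeries.X, PowerSeries.X)
  bdd := fun x => by
    obtain ⟨K, a, h⟩ := ls_bdd x.1
    obtain ⟨K', a', h'⟩ := ls_bdd x.2
    refine ⟨K + K', (PowerSeries.X ^ K' * a, PowerSeries.X ^ K * a'), ?_⟩
    ext1
    · rw [Prod.fst_mul, psi2_fst, psi2_fst, Prod.pow_fst, map_mul, ← h, pow_add, map_mul]
      ring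
    · rw [Prod.snd_mul, psi2_snd, psi2_snd, Prod.pow_snd, map_mul, ← h', pow_add, map_mul]
      ring
  fin1 := fun K => by
    obtain ⟨V, hV, h⟩ := ls_fin1 (R := R) K
    refine ⟨V.prod V, hV.prod hV, fun a => ?_⟩
    obtain ⟨b, hb⟩ := h a.1
    obtain ⟨c, hc⟩ := h a.2
    exact ⟨(b, c), hb, hc⟩
  fin2 := fun K => by
    refine ⟨_, Submodule.fg_span (Set.finite_range _), fun a a' h => laurent_span_mem K a ?_ ?_⟩
    · intro n hn
      have h2 := congrArg Prod.snd h
      rw [Prod.snd_mul, psi2_snd, psi2_snd, phi2_snd, Prod.pow_snd] at h2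
      have := coeff_of_X_pow_mul h2 n hn
      rwa [phiL_coeff] at this
    · intro n hn
      have h2 := congrArg Prod.fst h
      rw [Prod.fst_mul, psi2_fst, psi2_fst, phi2_fst, Prod.pow_fst] at h2
      have := coeff_of_X_pow_mul h2 (-n) (by omega)
      rw [phiL_coeff] at this
      simpa using this
  const := fun a a' h => by
    have hc : ∀ n : ℤ, n ≠ 0 → a.coeff n = 0 := by
      intro n hn
      rcases lt_or_gt_of_ne hn with hn | hn
      · have h2 := congrArg Prod.snd h
        rw [psi2_snd, phi2_snd] at h2
        have := coeff_of_X_pow_mul (K := 0) (x := phiL R a) (a := a'.2)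
          (by rw [pow_zero, map_one, one_mul, h2]) n (by omega)
        rwa [phiL_coeff] at this
      · have h2 := congrArg Prod.fst h
        rw [psi2_fst, phi2_fst] at h2
        have := coeff_of_X_pow_mul (K := 0) (x := phiL R (LaurentPolynomial.invert a)) (a := a'.1)
          (by rw [pow_zero, map_one, one_mul, h2]) (-n) (by omega)
        rw [phiL_coeff] at this
        simpa using this
    refine ⟨a.coeff 0, ?_⟩
    ext n
    change _ = (LaurentPolynomial.C (a.coeff 0)).coeff n
    rw [← phiL_coeff (LaurentPolynomial.C _), phiL_C, HahnSeries.coeff_single]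
    split_ifs with hn
    · rw [hn]
    · exact hc n hn
  ε := AddMonoidAlgebra.lift R R ℤ 1

/-! ### The implications (ii) ⇒ (i) and (iv) ⇒ (ii) -/

theorem two_imp_one (R : Type) [CommRing R] [IsLocalRing R] (r : ℕ)
    (h : ∀ v : Fin (r + 1) → LaurentPolynomial R, IsUnimodular v → IsCompletable v)
    (v : Fin (r + 1) → R[X]) (hv : IsUnimodular v) : IsCompletable v := by
  obtain ⟨M0, M1, h1, h2, h3⟩ := exists_red (Polynomial.mapRingHom (residue R))
    (Polynomial.map_surjective _ residue_surjective)
    ((maximalIdeal R).map (algebraMap R R[X]))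
    (by rw [Polynomial.ker_mapRingHom, ker_residue]; exact le_rfl) v hv
  refine (rob1 R).main (hLift_mLs r) v hv M0 M1 h1 h2 h3 ?_
  have := ((h _ (hv.map' Polynomial.toLaurent)).map'
    ((phiL R).comp (LaurentPolynomial.invert (R := R)).toAlgHom).toRingHom)
  convert this using 2 with i
  exact polyL_eq (v i)

theorem laurent_pid (k : Type) [Field k] : IsPrincipalIdealRing (LaurentPolynomial k) := by
  refine ⟨fun J => ?_⟩
  rw [← IsLocalization.map_under (Submonoid.powers (X : k[X])) (LaurentPolynomial k) J]
  obtain ⟨g, hg⟩ := (IsPrincipalIdealRing.principal (Ideal.under k[X] J)).principal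
  rw [hg]
  refine ⟨⟨algebraMap _ _ g, ?_⟩⟩
  exact (Ideal.map_span _ _).trans (by rw [Set.image_singleton])

theorem laurent_surj (R : Type) [CommRing R] [IsLocalRing R] :
    Function.Surjective (AddMonoidAlgebra.mapRingHom ℤ (residue R) :
      LaurentPolynomial R →+* LaurentPolynomial (ResidueField R)) := by
  intro p
  induction p using LaurentPolynomial.induction_on' with
  | add p q hp hq =>
    obtain ⟨a, rfl⟩ := hp
    obtain ⟨b, rfl⟩ := hq
    exact ⟨a + b, map_add _ _ _⟩
  | C_mul_T m a =>
    obtain ⟨b, rfl⟩ := residue_surjective a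
    refine ⟨AddMonoidAlgebra.single m b, ?_⟩
    rw [← LaurentPolynomial.single_eq_C_mul_T]
    exact AddMonoidAlgebra.mapRingHom_single _ _ _

theorem laurent_ker (R : Type) [CommRing R] [IsLocalRing R] :
    RingHom.ker (AddMonoidAlgebra.mapRingHom ℤ (residue R) :
      LaurentPolynomial R →+* LaurentPolynomial (ResidueField R)) ≤
      (maximalIdeal R).map (algebraMap R (LaurentPolynomial R)) := by
  intro p hp
  rw [RingHom.mem_ker] at hp
  have hc : ∀ n, p.coeff n ∈ maximalIdeal R := by
    intro n
    rw [← ker_residue, RingHom.mem_ker]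
    have := congrArg (fun q => q.coeff n) hp
    simpa using this
  rw [← AddMonoidAlgebra.sum_coeff_single p, Finsupp.sum]
  refine Ideal.sum_mem _ fun n _ => ?_
  rw [LaurentPolynomial.single_eq_C_mul_T]
  exact Ideal.mul_mem_right _ _ (Ideal.mem_map_of_mem (algebraMap R (LaurentPolynomial R)) (hc n))

theorem four_imp_two (R : Type) [CommRing R] [IsLocalRing R] (r : ℕ)
    (h : ∀ v : Fin (r + 1) → LaurentSeries R, IsUnimodular v → IsCompletable v)
    (v : Fin (r + 1) → LaurentPolynomial R) (hv : IsUnimodular v) : IsCompletable v := by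
  have := laurent_pid (ResidueField R)
  obtain ⟨M0, M1, h1, h2, h3⟩ := exists_red _ (laurent_surj R) _ (laurent_ker R) v hv
  have hL : HLift _ ((mLs R).prod (mLs R)) r := (hLift_mLs r).prod (hLift_mLs r)
  have c1 := h _ (hv.map' ((phiL R).comp (LaurentPolynomial.invert (R := R)).toAlgHom).toRingHom)
  have c2 := h _ (hv.map' (phiL R).toRingHom)
  have c3 := c1.prod c2
  have c4 : IsCompletable (fun i => (rob2 R).φ (v i)) := c3
  exact (rob2 R).main hL v hv M0 M1 h1 h2 h3 c4

/-! ### The implication (iii) ⇒ (iv) -/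

theorem X_pow_mul_polyL {R : Type} [CommRing R] (p : R[X]) (d : ℕ) (hd : p.natDegree ≤ d) :
    ∃ g : PowerSeries R, psiL R (PowerSeries.X ^ d) * polyL R p = psiL R g ∧
      PowerSeries.constantCoeff g = p.coeff d := by
  refine ⟨PowerSeries.mk fun n => if n ≤ d then p.coeff (d - n) else 0, ?_, ?_⟩
  · ext n
    rw [psiL_X_pow, HahnSeries.coeff_single_mul, one_mul, polyL_coeff, psiL_coeff,
      PowerSeries.coeff_mk]
    rcases lt_or_ge n 0 with h | h
    · rw [if_pos (by omega), if_pos h]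
      exact Polynomial.coeff_eq_zero_of_natDegree_lt (by omega)
    · rw [if_neg (show ¬ n < 0 by omega)]
      by_cases h2 : n.natAbs ≤ d
      · rw [if_pos h2, if_pos (by omega)]; congr 1; omega
      · rw [if_neg h2, if_neg (by omega)]
  · rw [← PowerSeries.coeff_zero_eq_constantCoeff_apply, PowerSeries.coeff_mk]
    simp

theorem isUnit_polyL {R : Type} [CommRing R] (p : R[X]) (hp : p.Monic) : IsUnit (polyL R p) := by
  obtain ⟨g, hg, hg0⟩ := X_pow_mul_polyL p p.natDegree le_rfl
  rw [hp.coeff_natDegree] at hg0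
  have : IsUnit (psiL R g) := by
    apply IsUnit.map
    rw [PowerSeries.isUnit_iff_constantCoeff, hg0]
    exact isUnit_one
  rw [← hg] at this
  exact isUnit_of_mul_isUnit_right this

theorem three_imp_four (R : Type) [CommRing R] [IsLocalRing R] (r : ℕ)
    (h : ∀ v : Fin (r + 1) → MonicLoc R, IsUnimodular v → IsCompletable v)
    (v : Fin (r + 1) → LaurentSeries R) (hv : IsUnimodular v) : IsCompletable v := by
  obtain ⟨w, hw⟩ := (isUnimodular_iff v).mp hv
  obtain ⟨d, hd⟩ := (rob1 R).bdd_le w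
  change ∀ i, ∃ a', psiL R (PowerSeries.X ^ d) * w i = psiL R a' at hd
  choose b hb using hd
  obtain ⟨E', hE⟩ := (isUnit_psiL_X_pow (R := R) (d + 1)).exists_right_inv
  obtain ⟨E, hEdef⟩ : ∃ E, E = psiL R (PowerSeries.X ^ (d + 1)) := ⟨_, rfl⟩
  have hEu : IsUnit E := hEdef ▸ isUnit_psiL_X_pow (d + 1)
  rw [← hEdef] at hE
  have hE'u : IsUnit E' := IsUnit.of_mul_eq_one_right _ hE
  choose p a hpa _ _ using fun i => ls_dec (E' * v i)
  have hv' : ∀ i, v i + (∑ i, v i * w i) * (-(E * psiL R (a i))) = E * polyL R (p i) := by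
    intro i
    rw [hw]
    have : v i = E * (E' * v i) := by rw [← mul_assoc, hE, one_mul]
    rw [this, hpa]; ring
  have hunit : IsUnit (1 + ∑ i, (-(E * psiL R (a i))) * w i) := by
    have : 1 + ∑ i, (-(E * psiL R (a i))) * w i =
        psiL R (1 - PowerSeries.X * ∑ i, a i * b i) := by
      rw [map_sub, map_one, map_mul, map_sum, Finset.mul_sum, sub_eq_add_neg,
        ← Finset.sum_neg_distrib]
      congr 1
      refine Finset.sum_congr rfl fun i _ => ?_
      rw [map_mul, ← hb, hEdef, pow_succ, map_mul]
      ring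
    rw [this]
    apply IsUnit.map
    rw [PowerSeries.isUnit_iff_constantCoeff]
    simp
  refine IsCompletable.of_rank_one w (fun i => -(E * psiL R (a i))) hunit ?_
  simp only [hv']
  apply IsCompletable.of_smul E' hE'u
  have e : ∀ i, E' * (E * polyL R (p i)) = polyL R (p i) := fun i => by
    rw [← mul_assoc, mul_comm E', hE, one_mul]
  simp only [e]
  have hum : IsUnimodular (fun i => polyL R (p i)) := by
    apply isUnimodular_of_isUnit _ (fun i => E * w i)
    convert hunit using 1
    rw [← hw, ← Finset.sum_add_distrib]
    refine Finset.sum_congr rfl fun i _ => ?_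
    have := hv' i
    rw [hw, one_mul] at this
    linear_combination (- w i) * this
  -- lift to polynomials
  have hq : ∃ q : Fin (r + 1) → R[X], (∑ i, p i * q i).Monic := by
    obtain ⟨W, hW⟩ := (isUnimodular_iff _).mp hum
    let N := ∑ i, (p i).natDegree
    have hN : ∀ i, (p i).natDegree ≤ N := fun i =>
      Finset.single_le_sum (f := fun i => (p i).natDegree) (fun _ _ => Nat.zero_le _)
        (Finset.mem_univ i)
    choose q c hqc _ _ using fun i => ls_dec (polyL R (X ^ (N + 1)) * W i)
    choose g hg _ using fun i => X_pow_mul_polyL (p i) N (hN i)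
    refine ⟨q, ?_⟩
    have hF : polyL R (∑ i, p i * q i) = polyL R (X ^ (N + 1)) - ∑ i, polyL R (p i) * psiL R (c i) := by
      rw [map_sum, eq_sub_iff_add_eq, ← Finset.sum_add_distrib]
      rw [← mul_one (polyL R (X ^ (N + 1))), ← hW, Finset.mul_sum]
      refine Finset.sum_congr rfl fun i _ => ?_
      rw [map_mul]
      linear_combination (-polyL R (p i)) * hqc i
    have hcoeff : ∀ k, N < k → (∑ i, p i * q i).coeff k = (X ^ (N + 1) : R[X]).coeff k := by
      intro k hk
      have h1 : psiL R (PowerSeries.X ^ N) * (∑ i, polyL R (p i) * psiL R (c i)) =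
          psiL R (∑ i, g i * c i) := by
        rw [Finset.mul_sum, map_sum]
        refine Finset.sum_congr rfl fun i _ => ?_
        rw [map_mul, ← hg]; ring
      have h2 := coeff_of_X_pow_mul h1 (-k) (by omega)
      have h3 := congrArg (fun y => HahnSeries.coeff y (-(k : ℤ))) hF
      rw [HahnSeries.coeff_sub, h2, sub_zero, polyL_coeff, polyL_coeff, if_pos (by omega),
        if_pos (by omega)] at h3
      simpa using h3
    apply Polynomial.monic_of_natDegree_le_of_coeff_eq_one (N + 1)
    · rw [Polynomial.natDegree_le_iff_coeff_eq_zero]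
      intro k hk
      rw [hcoeff k (by omega), Polynomial.coeff_X_pow, if_neg (by omega)]
    · rw [hcoeff _ (by omega), Polynomial.coeff_X_pow, if_pos rfl]
  obtain ⟨q, hq⟩ := hq
  have hum2 : IsUnimodular (fun i => algebraMap R[X] (MonicLoc R) (p i)) := by
    apply isUnimodular_of_isUnit _ (fun i => algebraMap R[X] (MonicLoc R) (q i))
    simp only [← map_mul, ← map_sum]
    exact IsLocalization.map_units (MonicLoc R) (⟨_, hq⟩ : monicSubmonoid R)
  have hρ : ∀ y : monicSubmonoid R, IsUnit ((polyL R).toRingHom y) := fun y => isUnit_polyL _ y.2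
  have := (h _ hum2).map' (IsLocalization.lift (S := MonicLoc R) hρ)
  simp only [IsLocalization.lift_eq] at this
  exact this

/-! ### The implication (i) ⇒ (iii) -/

theorem monicSubmonoid_le (R : Type) [CommRing R] : monicSubmonoid R ≤ nonZeroDivisors R[X] :=
  fun _ hp => Polynomial.Monic.mem_nonZeroDivisors hp

theorem clear_row {R : Type} [CommRing R] {n : ℕ} (v : Fin n → MonicLoc R) :
    ∃ (b : R[X]) (p : Fin n → R[X]), b.Monic ∧
      ∀ i, algebraMap R[X] (MonicLoc R) b * v i = algebraMap R[X] (MonicLoc R) (p i) := by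
  obtain ⟨b, hb⟩ := IsLocalization.exist_integer_multiples_of_finite (monicSubmonoid R) v
  choose p hp using hb
  refine ⟨b, p, b.2, fun i => ?_⟩
  rw [hp, Algebra.smul_def]
  

theorem clear_unimodular {R : Type} [CommRing R] {n : ℕ} (p : Fin n → R[X])
    (h : IsUnimodular (fun i => algebraMap R[X] (MonicLoc R) (p i))) :
    ∃ q : Fin n → R[X], (∑ i, p i * q i).Monic := by
  obtain ⟨w, hw⟩ := (isUnimodular_iff _).mp h
  obtain ⟨b, q, hb, hq⟩ := clear_row w
  refine ⟨q, ?_⟩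
  have : ∑ i, p i * q i = b := by
    apply IsLocalization.injective (MonicLoc R) (monicSubmonoid_le R)
    rw [← mul_one (algebraMap _ _ b), ← hw, map_sum, Finset.mul_sum]
    refine Finset.sum_congr rfl fun i _ => ?_
    rw [map_mul, ← hq]; ring
  rwa [this]

theorem IsUnimodular.rank_one {A : Type} [CommRing A] {n : ℕ} {v : Fin n → A}
    (hv : IsUnimodular v) (w u : Fin n → A) (hu : IsUnit (1 + ∑ i, u i * w i)) :
    IsUnimodular (fun j => v j + (∑ i, v i * w i) * u j) := by
  obtain ⟨x, hx⟩ := (isUnimodular_iff _).mp hv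
  obtain ⟨e, he⟩ := hu.exists_right_inv
  refine (isUnimodular_iff _).mpr ⟨fun j => x j - w j * ((∑ i, u i * x i) * e), ?_⟩
  have h1 : ∑ j, (v j + (∑ i, v i * w i) * u j) * (x j - w j * ((∑ i, u i * x i) * e)) =
      ∑ j, v j * x j + (∑ i, v i * w i) * (∑ j, u j * x j)
      - (∑ j, v j * w j + (∑ i, v i * w i) * (∑ j, u j * w j)) * ((∑ i, u i * x i) * e) := by
    generalize hs : (∑ i, v i * w i) = s
    generalize (∑ i, u i * x i) * e = t
    have h0 : ∀ j, (v j + s * u j) * (x j - w j * t) =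
        v j * x j + s * (u j * x j) - (v j * w j) * t - (s * (u j * w j)) * t := fun j => by ring
    simp only [h0, Finset.sum_add_distrib, Finset.sum_sub_distrib, ← Finset.mul_sum,
      ← Finset.sum_mul, hs]
    ring
  rw [h1, hx]
  linear_combination (-(∑ i, v i * w i) * (∑ i, u i * x i)) * he

theorem poly_unimodular {R : Type} [CommRing R] [IsLocalRing R] {n : ℕ} (p q : Fin n → R[X])
    (hq : (∑ i, p i * q i).Monic) (j : Fin n)
    (hj : p j - 1 ∈ (maximalIdeal R).map (algebraMap R R[X])) : IsUnimodular p := by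
  let I : Ideal R[X] := Ideal.span (Set.range p)
  have hpI : ∀ i, p i ∈ I := fun i => Ideal.subset_span ⟨i, rfl⟩
  let F := ∑ i, p i * q i
  have hF : F ∈ I := Ideal.sum_mem _ fun i _ => Ideal.mul_mem_right _ _ (hpI i)
  have : I.restrictScalars R = ⊤ := by
    apply nak_aux _ (Submodule.span R (Set.range fun i : Fin F.natDegree => (X ^ (i : ℕ) : R[X])))
      (Submodule.fg_span (Set.finite_range _))
    · intro a _
      rw [← Polynomial.modByMonic_add_div a F, add_comm]
      refine Submodule.add_mem_sup (I.mul_mem_right _ hF) (span_X_pow_mem _ _ ?_)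
      intro i hi
      apply Polynomial.coeff_eq_zero_of_degree_lt
      refine (Polynomial.degree_modByMonic_lt a hq).trans_le ?_
      exact Polynomial.degree_le_natDegree.trans (by exact_mod_cast hi)
    · intro a _
      rw [show a = p j * a + (-(p j - 1)) * a by ring]
      refine Submodule.add_mem_sup (I.mul_mem_right _ (hpI j)) ?_
      rw [Ideal.smul_top_eq_map]
      exact Ideal.mul_mem_right _ _ (neg_mem hj)
  rw [IsUnimodular, Ideal.eq_top_iff_one]
  change (1 : R[X]) ∈ I.restrictScalars R
  rw [this]
  trivial

theorem one_imp_three (R : Type) [CommRing R] [IsLocalRing R] (r : ℕ) (hr : 2 ≤ r)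
    (h : ∀ v : Fin (r + 1) → R[X], IsUnimodular v → IsCompletable v)
    (v : Fin (r + 1) → MonicLoc R) (hv : IsUnimodular v) : IsCompletable v := by
  classical
  have hmu : ∀ f : R[X], f.Monic → IsUnit (algebraMap R[X] (MonicLoc R) f) := fun f hf =>
    IsLocalization.map_units (MonicLoc R) (⟨_, hf⟩ : monicSubmonoid R)
  obtain ⟨α, hα⟩ : ∃ α, α = algebraMap R[X] (MonicLoc R) := ⟨_, rfl⟩
  rw [← hα] at hmu
  -- clear denominators
  obtain ⟨b, p, hb, hp⟩ := clear_row v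
  rw [← hα] at hp
  apply IsCompletable.of_smul (α b) (hmu b hb)
  simp only [hp]
  have hup : IsUnimodular (fun i => α (p i)) := by
    obtain ⟨w, hw⟩ := (isUnimodular_iff _).mp hv
    apply isUnimodular_of_isUnit _ w
    have : ∑ i, α (p i) * w i = α b := by
      rw [← mul_one (α b), ← hw, Finset.mul_sum]
      refine Finset.sum_congr rfl fun i _ => ?_
      rw [← hp]; ring
    rw [this]
    exact hmu b hb
  obtain ⟨q, hq⟩ := clear_unimodular p (hα ▸ hup)
  -- a coordinate which is nonzero modulo `m`
  have hi : ∃ i, (p i).map (residue R) ≠ 0 := by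
    by_contra! hcon
    have h1 := hq.map (residue R)
    rw [Polynomial.map_sum] at h1
    simp only [Polynomial.map_mul, hcon, zero_mul, Finset.sum_const_zero] at h1
    exact Polynomial.not_monic_zero h1
  obtain ⟨i, hi⟩ := hi
  obtain ⟨j, hij⟩ : ∃ j : Fin (r + 1), i ≠ j := by
    have : Nontrivial (Fin (r + 1)) := Fin.nontrivial_iff_two_le.mpr (by omega)
    obtain ⟨j, hj⟩ := exists_ne i
    exact ⟨j, hj.symm⟩
  obtain ⟨c, hc⟩ := residue_surjective (((p i).map (residue R)).leadingCoeff⁻¹)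
  have hmon : ((C c * p i).map (residue R)).Monic := by
    rw [Polynomial.map_mul, Polynomial.map_C, hc]
    apply Polynomial.monic_C_mul_of_mul_leadingCoeff_eq_one
    exact inv_mul_cancel₀ (Polynomial.leadingCoeff_ne_zero.mpr hi)
  obtain ⟨q0, hq0, -, hq0m⟩ := Polynomial.lifts_and_natDegree_eq_and_monic
    (Polynomial.mem_lifts _ |>.mpr ⟨_, rfl⟩) hmon
  let z : R[X] := (q0 - 1) * p j - C c * p i * p j
  let p' : Fin (r + 1) → R[X] := fun k => p k + z * (if k = j then 1 else 0)
  let w1 : Fin (r + 1) → MonicLoc R := fun k =>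
    if k = j then α (q0 - 1) else if k = i then - α (C c * p j) else 0
  let u1 : Fin (r + 1) → MonicLoc R := fun k => if k = j then 1 else 0
  have hu1 : IsUnit (1 + ∑ k, u1 k * w1 k) := by
    have : 1 + ∑ k, u1 k * w1 k = α q0 := by
      simp only [u1, ite_mul, one_mul, zero_mul, Finset.sum_ite_eq', Finset.mem_univ, if_true]
      simp [w1]
    rw [this]
    exact hmu _ hq0m
  have hsum : ∑ k, α (p k) * w1 k = α z := by
    have : ∀ k, α (p k) * w1 k = (if k = j then α (p j) * α (q0 - 1) else 0) +
        (if k = i then - (α (p i) * α (C c * p j)) else 0) := by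
      intro k
      simp only [w1]
      by_cases hkj : k = j
      · subst hkj
        simp [hij.symm]
      · by_cases hki : k = i
        · subst hki; simp only [hkj, if_true, if_false]; ring
        · simp [hkj, hki]
    simp only [this, Finset.sum_add_distrib, Finset.sum_ite_eq', Finset.mem_univ, if_true]
    simp only [z, map_sub, map_mul, map_one]
    ring
  have hp' : ∀ k, α (p k) + (∑ k, α (p k) * w1 k) * u1 k = α (p' k) := by
    intro k
    rw [hsum]
    simp only [p', u1, map_add, map_mul]
    split_ifs <;> simp
  apply IsCompletable.of_rank_one w1 u1 hu1
  have hup' := hup.rank_one w1 u1 hu1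
  simp only [hp'] at hup' ⊢
  have hjm : p' j ∈ (maximalIdeal R).map (algebraMap R R[X]) := by
    rw [Polynomial.algebraMap_eq, ← ker_residue, ← Polynomial.ker_mapRingHom, RingHom.mem_ker]
    simp only [p', z, if_true, mul_one, Polynomial.coe_mapRingHom, Polynomial.map_add,
      Polynomial.map_sub, Polynomial.map_mul, hq0, Polynomial.map_one]
    ring
  clear_value p'
  clear hp' hsum hu1 hup
  obtain ⟨w, hw⟩ := clear_unimodular p' (hα ▸ hup')
  -- second step
  let M := (w j).natDegree + 1
  let p2 : Fin (r + 1) → R[X] := fun k => X ^ M * p' k + (if k = j then 1 else 0)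
  have hF : ∑ k, p2 k * w k = X ^ M * (∑ k, p' k * w k) + w j := by
    simp only [p2, add_mul, Finset.sum_add_distrib, Finset.mul_sum, mul_assoc]
    simp
  have hFm : (∑ k, p2 k * w k).Monic := by
    rw [hF]
    apply Polynomial.Monic.add_of_left ((Polynomial.monic_X_pow M).mul hw)
    rw [Polynomial.Monic.degree_mul hw, Polynomial.degree_X_pow]
    have h1 : (w j).degree < (M : WithBot ℕ) :=
      Polynomial.degree_le_natDegree.trans_lt (by exact_mod_cast Nat.lt_succ_self _)
    refine h1.trans_le ?_
    rw [Polynomial.degree_eq_natDegree hw.ne_zero]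
    exact_mod_cast Nat.le_add_right _ _
  have hup2 : IsUnimodular p2 := by
    apply poly_unimodular p2 w hFm j
    simp only [p2, if_true, add_sub_cancel_right]
    exact Ideal.mul_mem_left _ _ hjm
  have hcomp := (h p2 hup2).map' α
  apply IsCompletable.of_smul (α (X ^ M)) (hmu _ (Polynomial.monic_X_pow M))
  obtain ⟨g, hg⟩ := (hmu _ ((Polynomial.monic_X_pow M).mul hw)).exists_right_inv
  have hone : ∑ k, α (X ^ M) * α (p' k) * (α (w k) * g) = 1 := by
    rw [← hg, map_mul, map_sum, Finset.mul_sum, Finset.sum_mul]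
    refine Finset.sum_congr rfl fun k _ => ?_
    rw [map_mul]; ring
  apply IsCompletable.of_rank_one (fun k => α (w k) * g) (fun k => if k = j then 1 else 0)
  · have : 1 + ∑ k, (if k = j then (1 : MonicLoc R) else 0) * (α (w k) * g) =
        α (∑ k, p2 k * w k) * g := by
      rw [hF, map_add, add_mul, hg]
      simp
    rw [this]
    exact (hmu _ hFm).mul (IsUnit.of_mul_eq_one_right _ hg)
  · rw [hone]
    convert hcomp using 2 with k
    simp only [p2, map_add, map_mul, one_mul]
    split_ifs <;> simp

/-- **Theorem (unimodular rows).** Let `(R, m)` be a commutative local ring and `r ≥ 2`.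
The following are equivalent: all unimodular rows of length `r+1` are completable over
(i) `R[t]`; (ii) `R[t,t⁻¹]`; (iii) `R⟨t⟩`; (iv) `R((t))`. -/
theorem unimodular_completable_tfae_of_local (R : Type) [CommRing R] [IsLocalRing R]
    (r : ℕ) (hr : 2 ≤ r) :
    List.TFAE
      [∀ v : Fin (r + 1) → Polynomial R, IsUnimodular v → IsCompletable v,
       ∀ v : Fin (r + 1) → LaurentPolynomial R, IsUnimodular v → IsCompletable v,
       ∀ v : Fin (r + 1) → MonicLoc R, IsUnimodular v → IsCompletable v,
       ∀ v : Fin (r + 1) → LaurentSeries R, IsUnimodular v → IsCompletable v] := by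
  tfae_have 1 → 3 := one_imp_three R r hr
  tfae_have 3 → 4 := three_imp_four R r
  tfae_have 4 → 2 := four_imp_two R r
  tfae_have 2 → 1 := two_imp_one R r
  tfae_finish
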